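/- Let 𝒳 be a set, let P ⊆ 𝒳 be a finite nonempty pool set, let M ⊆ 𝒳 be a finite set of already-selected points, let ε ∈ (0, 1), and let N ∈ {1, …, |P|}. Let d₁, d₂ be pseudometrics on 𝒳 such that (1 − ε) d₁(x, y) ≤ d₂(x, y) ≤ (1 + ε) d₁(x, y) for all x, y ∈ P ∪ M. Let x₁, …, x_N be a sequence of distinct points of P selected greedily with respect to d₂, and let B := {x₁, …, x_N}. Then Δ_{d₁}(B) ≤ 2 (1 + ε)/(1 − ε) · Δ_{d₁}^N. -/

import Mathlib

open scoped ENNReal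

/-- `minDistE d x S = inf_{y ∈ S} d(x, y)`, with the infimum over the empty set being `+∞`. -/
noncomputable def minDistE {𝒳 : Type*} (d : 𝒳 → 𝒳 → ℝ) (x : 𝒳) (S : Finset 𝒳) : ℝ≥0∞ :=
  ⨅ y ∈ S, ENNReal.ofReal (d x y)

/-- `Δ_d(B) = max_{x ∈ P} inf_{y ∈ M ∪ B} d(x, y)`. -/
noncomputable def deltaCover {𝒳 : Type*} [DecidableEq 𝒳] (d : 𝒳 → 𝒳 → ℝ)
    (P M B : Finset 𝒳) : ℝ≥0∞ :=
  ⨆ x ∈ P, minDistE d x (M ∪ B)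

/-- `Δ_d^N = min_{B ⊆ P, |B| = N} Δ_d(B)`. -/
noncomputable def deltaOpt {𝒳 : Type*} [DecidableEq 𝒳] (d : 𝒳 → 𝒳 → ℝ)
    (P M : Finset 𝒳) (N : ℕ) : ℝ≥0∞ :=
  ⨅ B : Finset 𝒳, ⨅ _ : B ⊆ P ∧ B.card = N, deltaCover d P M B

theorem minDistE_le {𝒳 : Type*} (d : 𝒳 → 𝒳 → ℝ) (p : 𝒳) {S : Finset 𝒳} {y : 𝒳} (hy : y ∈ S) :
    minDistE d p S ≤ ENNReal.ofReal (d p y) :=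
  iInf₂_le y hy

theorem minDistE_anti {𝒳 : Type*} (d : 𝒳 → 𝒳 → ℝ) (p : 𝒳) {S T : Finset 𝒳} (h : S ⊆ T) :
    minDistE d p T ≤ minDistE d p S :=
  le_iInf₂ fun _ hy => minDistE_le d p (h hy)

theorem exists_minDistE_eq {𝒳 : Type*} (d : 𝒳 → 𝒳 → ℝ) (p : 𝒳) {S : Finset 𝒳}
    (hS : S.Nonempty) : ∃ y ∈ S, minDistE d p S = ENNReal.ofReal (d p y) := by
  obtain ⟨y, hy, hmin⟩ := S.exists_min_image (fun y => ENNReal.ofReal (d p y)) hS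
  exact ⟨y, hy, le_antisymm (minDistE_le d p hy) (le_iInf₂ hmin)⟩

theorem minDistE_le_mul {𝒳 : Type*} {d d' : 𝒳 → 𝒳 → ℝ} {c : ℝ} (hc : 0 < c) (p : 𝒳)
    (S : Finset 𝒳) (h : ∀ y ∈ S, d p y ≤ c * d' p y) :
    minDistE d p S ≤ ENNReal.ofReal c * minDistE d' p S := by
  rcases S.eq_empty_or_nonempty with rfl | hS
  · simp [minDistE, ENNReal.mul_top, hc]
  · obtain ⟨y, hy, hyd⟩ := exists_minDistE_eq d' p hS
    rw [hyd, ← ENNReal.ofReal_mul hc.le]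
    exact (minDistE_le d p hy).trans (ENNReal.ofReal_le_ofReal (h y hy))

theorem minDistE_le_deltaCover {𝒳 : Type*} [DecidableEq 𝒳] (d : 𝒳 → 𝒳 → ℝ)
    {P : Finset 𝒳} (M B : Finset 𝒳) {p : 𝒳} (hp : p ∈ P) :
    minDistE d p (M ∪ B) ≤ deltaCover d P M B :=
  le_iSup₂ (f := fun x (_ : x ∈ P) => minDistE d x (M ∪ B)) p hp

theorem deltaCover_le_mul {𝒳 : Type*} [DecidableEq 𝒳] {d d' : 𝒳 → 𝒳 → ℝ} {c : ℝ} (hc : 0 < c)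
    {P M B : Finset 𝒳} (hB : B ⊆ P)
    (h : ∀ x ∈ P ∪ M, ∀ y ∈ P ∪ M, d x y ≤ c * d' x y) :
    deltaCover d P M B ≤ ENNReal.ofReal c * deltaCover d' P M B := by
  refine iSup₂_le fun p hp => (minDistE_le_mul hc p (M ∪ B) fun y hy => ?_).trans
    (mul_le_mul_right (minDistE_le_deltaCover d' M B hp) _)
  refine h p (Finset.mem_union_left _ hp) y ?_
  rcases Finset.mem_union.1 hy with hy | hy
  · exact Finset.mem_union_right _ hy
  · exact Finset.mem_union_left _ (hB hy)

/-- If more than `|B|` points of `P` are at distance at least `r` from each other and from `M`,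
then `B` has covering radius at least `r / 2`. -/
theorem le_two_mul_deltaCover_of_separated {𝒳 ι : Type*} [DecidableEq 𝒳] [Fintype ι]
    {d : 𝒳 → 𝒳 → ℝ} (hsymm : ∀ x y, d x y = d y x) (htri : ∀ x y z, d x z ≤ d x y + d y z)
    {P M B : Finset 𝒳} (hB : B.Nonempty) (q : ι → 𝒳) (hqP : ∀ i, q i ∈ P)
    (hcard : B.card < Fintype.card ι) {r : ℝ≥0∞}
    (hM : ∀ i, ∀ m ∈ M, r ≤ ENNReal.ofReal (d (q i) m))
    (hq : ∀ i j, i ≠ j → r ≤ ENNReal.ofReal (d (q i) (q j))) :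
    r ≤ 2 * deltaCover d P M B := by
  have hne : (M ∪ B).Nonempty := hB.mono Finset.subset_union_right
  choose f hf hfd using fun i => exists_minDistE_eq d (q i) hne
  have hfR : ∀ i, ENNReal.ofReal (d (q i) (f i)) ≤ deltaCover d P M B := fun i =>
    hfd i ▸ minDistE_le_deltaCover d M B (hqP i)
  by_cases hfM : ∃ i, f i ∈ M
  · obtain ⟨i, hi⟩ := hfM
    exact ((hM i _ hi).trans (hfR i)).trans (le_mul_of_one_le_left' one_le_two)
  · push Not at hfM
    obtain ⟨i, -, j, -, hij, hfij⟩ := Finset.exists_ne_map_eq_of_card_lt_of_maps_to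
      (s := Finset.univ) (t := B) (f := f) (by simpa using hcard)
      (fun i _ => (Finset.mem_union.1 (hf i)).resolve_left (hfM i))
    calc r ≤ ENNReal.ofReal (d (q i) (q j)) := hq i j hij
      _ ≤ ENNReal.ofReal (d (q i) (f i) + d (q j) (f j)) := by
        refine ENNReal.ofReal_le_ofReal ?_
        rw [hsymm (q j), ← hfij]
        exact htri _ _ _
      _ ≤ ENNReal.ofReal (d (q i) (f i)) + ENNReal.ofReal (d (q j) (f j)) :=
        ENNReal.ofReal_add_le
      _ ≤ 2 * deltaCover d P M B := by
        rw [two_mul]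
        exact add_le_add (hfR i) (hfR j)

/-- Greedy distance maximization is a `2`-approximation for the covering radius. -/
theorem deltaCover_greedy_le_two_mul {𝒳 : Type*} [DecidableEq 𝒳] {d : 𝒳 → 𝒳 → ℝ}
    (hrefl : ∀ x, d x x = 0) (hsymm : ∀ x y, d x y = d y x)
    (htri : ∀ x y z, d x z ≤ d x y + d y z) {P M B : Finset 𝒳} {N : ℕ} (hN : 1 ≤ N)
    (hB : B.card = N) (x : Fin N → 𝒳) (hxP : ∀ i, x i ∈ P)
    (hgreedy : ∀ i : Fin N, ∀ y ∈ P, (∀ j : Fin N, j < i → x j ≠ y) →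
      minDistE d y (M ∪ (Finset.univ.filter (fun j : Fin N => j < i)).image x)
        ≤ minDistE d (x i) (M ∪ (Finset.univ.filter (fun j : Fin N => j < i)).image x)) :
    deltaCover d P M (Finset.univ.image x) ≤ 2 * deltaCover d P M B := by
  refine iSup₂_le fun p hp => ?_
  by_cases hpx : ∃ i, x i = p
  · obtain ⟨i, rfl⟩ := hpx
    refine (minDistE_le d (x i) (y := x i) (by simp)).trans ?_
    simp [hrefl]
  push Not at hpx
  have hsel : ∀ i, minDistE d p (M ∪ Finset.univ.image x) ≤
      minDistE d (x i) (M ∪ (Finset.univ.filter (fun j : Fin N => j < i)).image x) := fun i =>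
    (minDistE_anti d p (Finset.union_subset_union_right
      (Finset.image_subset_image (Finset.filter_subset _ _)))).trans
      (hgreedy i p hp fun j _ => hpx j)
  have hlt : ∀ i j, j < i →
      minDistE d p (M ∪ Finset.univ.image x) ≤ ENNReal.ofReal (d (x i) (x j)) := fun i j hij =>
    (hsel i).trans (minDistE_le d _ (Finset.mem_union_right _
      (Finset.mem_image_of_mem x (by simpa using hij))))
  have hp_le : ∀ i, minDistE d p (M ∪ Finset.univ.image x) ≤ ENNReal.ofReal (d p (x i)) :=
    fun i => minDistE_le d p (by simp)
  refine le_two_mul_deltaCover_of_separated hsymm htri (Finset.card_pos.1 (by omega))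
    (fun o : Option (Fin N) => o.elim p x) ?_ (by simp [hB]) ?_ ?_
  · rintro (_ | i)
    exacts [hp, hxP i]
  · rintro (_ | i) m hm
    · exact minDistE_le d p (Finset.mem_union_left _ hm)
    · exact (hsel i).trans (minDistE_le d _ (Finset.mem_union_left _ hm))
  · rintro (_ | i) (_ | j) hij
    · exact absurd rfl hij
    · exact hp_le j
    · simpa only [Option.elim, hsymm (x i) p] using hp_le i
    · rcases lt_or_gt_of_ne (fun h : i = j => hij (h ▸ rfl)) with h | h
      · simpa only [Option.elim, hsymm (x i) (x j)] using hlt j i h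
      · exact hlt i j h

/-- Greedy distance maximization on a `(1 ± ε)`-approximation `d₂` of a pseudometric `d₁`
(e.g. the kernel distance of a sketched kernel) yields a batch whose `d₁`-covering radius is
suboptimal by a factor of at most `2 (1 + ε)/(1 − ε)`. -/
theorem stmt_7 {𝒳 : Type*} [DecidableEq 𝒳] (d₁ d₂ : 𝒳 → 𝒳 → ℝ)
    (h₁refl : ∀ x, d₁ x x = 0) (h₁symm : ∀ x y, d₁ x y = d₁ y x)
    (h₁tri : ∀ x y z, d₁ x z ≤ d₁ x y + d₁ y z)
    (h₂refl : ∀ x, d₂ x x = 0) (h₂symm : ∀ x y, d₂ x y = d₂ y x)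
    (h₂tri : ∀ x y z, d₂ x z ≤ d₂ x y + d₂ y z)
    (ε : ℝ) (hε : ε ∈ Set.Ioo (0 : ℝ) 1)
    (P M : Finset 𝒳) (hP : P.Nonempty) (N : ℕ) (hN₁ : 1 ≤ N) (hN₂ : N ≤ P.card)
    (happrox : ∀ x ∈ P ∪ M, ∀ y ∈ P ∪ M,
      (1 - ε) * d₁ x y ≤ d₂ x y ∧ d₂ x y ≤ (1 + ε) * d₁ x y)
    (x : Fin N → 𝒳) (hinj : Function.Injective x) (hxP : ∀ i, x i ∈ P)
    (hgreedy : ∀ i : Fin N, ∀ y ∈ P, (∀ j : Fin N, j < i → x j ≠ y) →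
      minDistE d₂ y (M ∪ (Finset.univ.filter (fun j : Fin N => j < i)).image x)
        ≤ minDistE d₂ (x i) (M ∪ (Finset.univ.filter (fun j : Fin N => j < i)).image x)) :
    deltaCover d₁ P M (Finset.univ.image x)
      ≤ ENNReal.ofReal (2 * (1 + ε) / (1 - ε)) * deltaOpt d₁ P M N := by
  obtain ⟨hε₀, hε₁⟩ := hε
  have hsub : 0 < 1 - ε := by linarith
  have hadd : 0 < 1 + ε := by linarith
  have hc : 0 < 2 * (1 + ε) / (1 - ε) := by positivity
  have hc₀ : ENNReal.ofReal (2 * (1 + ε) / (1 - ε)) ≠ 0 := (ENNReal.ofReal_pos.2 hc).ne'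
  unfold deltaOpt
  simp only [ENNReal.mul_iInf_of_ne hc₀ ENNReal.ofReal_ne_top]
  refine le_iInf₂ fun B hB => ?_
  have hxB : Finset.univ.image x ⊆ P := by
    simpa [Finset.image_subset_iff] using hxP
  calc deltaCover d₁ P M (Finset.univ.image x)
      ≤ ENNReal.ofReal (1 - ε)⁻¹ * deltaCover d₂ P M (Finset.univ.image x) :=
        deltaCover_le_mul (inv_pos.2 hsub) hxB fun a ha b hb =>
          (le_inv_mul_iff₀ hsub).2 (happrox a ha b hb).1
    _ ≤ ENNReal.ofReal (1 - ε)⁻¹ *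
          (2 * (ENNReal.ofReal (1 + ε) * deltaCover d₁ P M B)) := by
        gcongr
        refine (deltaCover_greedy_le_two_mul h₂refl h₂symm h₂tri hN₁ hB.2 x hxP hgreedy).trans ?_
        gcongr
        exact deltaCover_le_mul hadd hB.1 fun a ha b hb => (happrox a ha b hb).2
    _ = ENNReal.ofReal (2 * (1 + ε) / (1 - ε)) * deltaCover d₁ P M B := by
        rw [div_eq_inv_mul, ENNReal.ofReal_mul (inv_pos.2 hsub).le,
          ENNReal.ofReal_mul zero_le_two, ENNReal.ofReal_ofNat]
        ring
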